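/- arXiv:2509.14111 — 5 statements merged into one kernel-verified Lean document; each statement's English description precedes it below -/
import Mathlib

section
/- Let k ≥ 2 be an integer. Suppose that for every set of k−1 distinct positive integers u₁, …, u_{k−1} there exists a real number t with ‖t·uᵢ‖ ≥ 1/k for all i. Let v₁, …, v_k be distinct positive integers with gcd(v₁, …, v_k) = 1 such that the sum over all subsets S ⊆ {1, …, k} of gcd{vᵢ : i ∈ S} is strictly greater than (k(k+1)/2)^{k−1}. Then there exists a real number t such that ‖t·vᵢ‖ ≥ 1/(k+1) for all i ∈ {1, …, k}. -/
/-- The distance from a real number to the nearest integer. -/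
noncomputable def nearestDist (x : ℝ) : ℝ := ⨅ n : ℤ, |x - n|

theorem le_nearestDist_iff {c x : ℝ} : c ≤ nearestDist x ↔ ∀ n : ℤ, c ≤ |x - n| :=
  le_ciInf_iff ⟨0, by rintro _ ⟨n, rfl⟩; exact abs_nonneg _⟩

/-- The lonely runner property for `k - 1` distinct speeds gives it for `k` nonzero integer speeds
of which two have the same absolute value. -/
theorem exists_lonely_time_of_natAbs_eq {k : ℕ}
    (H : ∀ u : Fin (k - 1) → ℕ, (∀ i, 0 < u i) → Function.Injective u →
      ∃ t : ℝ, ∀ i, nearestDist (t * u i) ≥ 1 / k)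
    (f : Fin k → ℤ) (hf : ∀ l, f l ≠ 0) {i j : Fin k} (hij : i ≠ j)
    (habs : (f i).natAbs = (f j).natAbs) :
    ∃ t : ℝ, ∀ (l : Fin k) (n : ℤ), 1 / (k : ℝ) ≤ |t * f l - n| := by
  let g : Fin k → ℕ+ := fun l => ⟨(f l).natAbs, Int.natAbs_pos.mpr (hf l)⟩
  have hcard : (Finset.univ.image g).card ≤ k - 1 := by
    have hlt : (Finset.univ.image g).card < (Finset.univ : Finset (Fin k)).card := by
      refine lt_of_le_of_ne Finset.card_image_le fun h => hij ?_
      exact Finset.card_image_iff.mp h (Finset.mem_coe.mpr (Finset.mem_univ i))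
        (Finset.mem_coe.mpr (Finset.mem_univ j)) (Subtype.ext habs)
    rw [Finset.card_univ, Fintype.card_fin] at hlt
    omega
  obtain ⟨s, hs, hsc⟩ := Infinite.exists_superset_card_eq _ _ hcard
  let e := s.equivFinOfCardEq hsc
  obtain ⟨t, ht⟩ := H (fun a => ((e.symm a : ℕ+) : ℕ)) (fun a => (e.symm a : ℕ+).pos)
    (fun a b hab => e.symm.injective (Subtype.ext (PNat.coe_injective hab)))
  refine ⟨t, fun l n => ?_⟩
  have hl : g l ∈ s := hs (Finset.mem_image_of_mem g (Finset.mem_univ l))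
  have htl := le_nearestDist_iff.mp (ht (e ⟨g l, hl⟩))
  simp only [Equiv.symm_apply_apply] at htl
  have hg : ((g l : ℕ) : ℝ) = |(f l : ℝ)| := by
    change (((f l).natAbs : ℕ) : ℝ) = _
    rw [Nat.cast_natAbs, Int.cast_abs]
  rw [hg] at htl
  rcases abs_choice (f l : ℝ) with h | h
  · rw [h] at htl
    exact htl n
  · rw [h] at htl
    have := htl (-n)
    rwa [← abs_neg, show -(t * -(f l : ℝ) - ((-n : ℤ) : ℝ)) = t * f l - n by push_cast; ring]
      at this

/-- For non-parallel vectors `v > 0` and `w`, the mediant of some two of the slopes `w l / v l`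
differs from all of the slopes. -/
theorem exists_mediant_ne {ι : Type*} [Fintype ι] {v w : ι → ℤ} (hv : ∀ l, 0 < v l) {a b : ι}
    (hab : w a * v b ≠ w b * v a) :
    ∃ i j, i ≠ j ∧ ∀ l, (w i + w j) * v l - (v i + v j) * w l ≠ 0 := by
  classical
  let r : ι → ℚ := fun l => w l / v l
  have hv' : ∀ l, (0 : ℚ) < v l := fun l => by exact_mod_cast hv l
  have hle : ∀ {l m}, r l ≤ r m ↔ w l * v m ≤ w m * v l := fun {l m} => by
    rw [div_le_div_iff₀ (hv' l) (hv' m)]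
    exact_mod_cast Iff.rfl
  have hlt : ∀ {l m}, r l < r m ↔ w l * v m < w m * v l := fun {l m} => by
    rw [← not_le, hle, not_le]
  obtain ⟨i, -, hi⟩ := Finset.univ.exists_min_image r ⟨a, Finset.mem_univ a⟩
  have hne : (Finset.univ.filter fun l => r i < r l).Nonempty := by
    by_contra hemp
    have hall : ∀ l, r l = r i := fun l => by
      refine le_antisymm (not_lt.mp fun h => hemp ⟨l, by simpa using h⟩) (hi l (Finset.mem_univ l))
    refine hab (le_antisymm (hle.mp ?_) (hle.mp ?_)) <;> rw [hall a, hall b]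
  obtain ⟨j, hj, hjmin⟩ := Finset.exists_min_image _ r hne
  have hij : r i < r j := (Finset.mem_filter.mp hj).2
  refine ⟨i, j, fun h => hij.ne (congrArg r h), fun l => ?_⟩
  by_cases hl : r i < r l
  · have h1 := hlt.mp hl
    have h2 := hle.mp (hjmin l (by simpa using hl))
    nlinarith
  · have h1 := hle.mp (not_lt.mp hl)
    have h2 := hlt.mp ((not_lt.mp hl).trans_lt hij)
    nlinarith

/-- The lower corner of the lattice cube entered by the ray `t ↦ t • v` at time `t` through its
facets indexed by `S`. -/
noncomputable def enteredCube {ι : Type*} [DecidableEq ι] (v : ι → ℕ) (S : Finset ι) (t : ℝ)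
    (i : ι) : ℤ :=
  if i ∈ S then ⌊t * v i⌋ else ⌈t * v i⌉ - 1

section enteredCube

variable {ι : Type*} [DecidableEq ι] {v : ι → ℕ}

theorem sub_enteredCube_mem_Icc (S : Finset ι) (t : ℝ) (i : ι) :
    t * v i - enteredCube v S t i ∈ Set.Icc (0 : ℝ) 1 := by
  unfold enteredCube
  split_ifs
  · exact ⟨by linarith [Int.floor_le (t * v i)], by linarith [Int.lt_floor_add_one (t * v i)]⟩
  · push_cast
    exact ⟨by linarith [Int.ceil_lt_add_one (t * v i)], by linarith [Int.le_ceil (t * v i)]⟩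

theorem sub_enteredCube_eq_zero_iff {S : Finset ι} (hS : S.gcd v ≠ 0) (j : ℕ) (i : ι) :
    (j / S.gcd v : ℝ) * v i - enteredCube v S (j / S.gcd v) i = 0 ↔ i ∈ S := by
  unfold enteredCube
  split_ifs with h
  · obtain ⟨q, hq⟩ := Finset.gcd_dvd (f := v) h
    have hS' : ((S.gcd v : ℕ) : ℝ) ≠ 0 := Nat.cast_ne_zero.mpr hS
    have : (j / S.gcd v : ℝ) * v i = ((j * q : ℕ) : ℝ) := by
      rw [hq]
      push_cast
      field_simp
    rw [this, Int.floor_natCast]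
    simp [h]
  · simp only [h, iff_false]
    push_cast
    exact ne_of_gt (by linarith [Int.ceil_lt_add_one ((j / S.gcd v : ℝ) * v i)])

end enteredCube

/-- If the gcd sum of a primitive positive vector `v` of length `k` exceeds `N ^ (k - 1)`, then
some integer vector not parallel to `v` lies within `1 / N` of the line spanned by `v`. -/
theorem exists_close_to_line_of_gcd_sum {k N : ℕ} (hk : 0 < k) (hN : 0 < N) {v : Fin k → ℕ}
    (hpos : ∀ i, 0 < v i) (hgcd : Finset.univ.gcd v = 1)
    (hsum : N ^ (k - 1) < ∑ S : Finset (Fin k), S.gcd v) :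
    ∃ (w : Fin k → ℤ) (c : ℝ), (∃ a b, w a * v b ≠ w b * v a) ∧
      ∀ i, |N * (w i : ℝ) - c * v i| ≤ 1 := by
  have : NeZero N := ⟨hN.ne'⟩
  let F : (Σ S : Finset (Fin k), Fin (S.gcd v)) × Fin N → Fin k → ZMod N := fun p i =>
    ((enteredCube v p.1.1 ((p.1.2 : ℕ) / p.1.1.gcd v) i - (p.2 : ℕ) * v i : ℤ) : ZMod N)
  have hcard : Fintype.card (Fin k → ZMod N) <
      Fintype.card ((Σ S : Finset (Fin k), Fin (S.gcd v)) × Fin N) := by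
    simp only [Fintype.card_fun, ZMod.card, Fintype.card_fin, Fintype.card_prod,
      Fintype.card_sigma]
    calc N ^ k = N ^ (k - 1) * N := by rw [← pow_succ, Nat.sub_add_cancel hk]
      _ < _ := Nat.mul_lt_mul_of_pos_right hsum hN
  obtain ⟨⟨⟨S, j⟩, m⟩, ⟨⟨S', j'⟩, m'⟩, hne, heq⟩ := Fintype.exists_ne_map_eq_of_card_lt F hcard
  have hg : 0 < S.gcd v := j.pos
  have hg' : 0 < S'.gcd v := j'.pos
  have hgR : (0 : ℝ) < (S.gcd v : ℕ) := by exact_mod_cast hg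
  have hgR' : (0 : ℝ) < (S'.gcd v : ℕ) := by exact_mod_cast hg'
  have hNR : (0 : ℝ) < N := by exact_mod_cast hN
  have hvR : ∀ i, (0 : ℝ) < v i := fun i => by exact_mod_cast hpos i
  obtain ⟨t, ht⟩ : ∃ t : ℝ, t = (j : ℕ) / S.gcd v := ⟨_, rfl⟩
  obtain ⟨t', ht'⟩ : ∃ t : ℝ, t = (j' : ℕ) / S'.gcd v := ⟨_, rfl⟩
  have hdvd : ∀ i, ∃ q : ℤ, (enteredCube v S' t' i - (m' : ℕ) * v i) -
      (enteredCube v S t i - (m : ℕ) * v i) = N * q := fun i => by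
    have := congrFun heq i
    simp only [F, ← ht, ← ht'] at this
    exact (ZMod.intCast_eq_intCast_iff_dvd_sub _ _ _).mp this
  choose w hw using hdvd
  have hwR : ∀ i, N * (w i : ℝ) = (t' - m' - (t - m)) * v i +
      ((t * v i - enteredCube v S t i) - (t' * v i - enteredCube v S' t' i)) := fun i => by
    have := congrArg (Int.cast : ℤ → ℝ) (hw i)
    push_cast at this
    linarith
  have he := sub_enteredCube_mem_Icc (v := v) S t
  have he' := sub_enteredCube_mem_Icc (v := v) S' t'
  have hz : ∀ i, t * v i - enteredCube v S t i = 0 ↔ i ∈ S := fun i => by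
    rw [ht]; exact sub_enteredCube_eq_zero_iff hg.ne' _ i
  have hz' : ∀ i, t' * v i - enteredCube v S' t' i = 0 ↔ i ∈ S' := fun i => by
    rw [ht']; exact sub_enteredCube_eq_zero_iff hg'.ne' _ i
  refine ⟨w, t' - m' - (t - m), ?_, fun i => ?_⟩
  · by_contra! hpar
    have hq : ∃ q : ℤ, ∀ i, w i = q * v i := by
      have hd : ((v ⟨0, hk⟩ : ℕ) : ℤ) ∣ w ⟨0, hk⟩ := by
        have : v ⟨0, hk⟩ ∣ Finset.univ.gcd fun i => (w ⟨0, hk⟩).natAbs * v i :=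
          Finset.dvd_gcd fun i _ => by
            have := congrArg Int.natAbs (hpar i ⟨0, hk⟩)
            simp only [Int.natAbs_mul, Int.natAbs_natCast] at this
            exact ⟨(w i).natAbs, by rw [← this, mul_comm]⟩
        rw [Finset.gcd_mul_left, hgcd] at this
        exact Int.natCast_dvd.mpr (by simpa using this)
      obtain ⟨q, hq⟩ := hd
      refine ⟨q, fun i => ?_⟩
      have h0 : ((v ⟨0, hk⟩ : ℕ) : ℤ) ≠ 0 := by exact_mod_cast (hpos _).ne'
      apply mul_right_cancel₀ h0
      rw [hpar i ⟨0, hk⟩, hq]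
      ring
    obtain ⟨q, hq⟩ := hq
    obtain ⟨μ, hμ⟩ : ∃ μ : ℝ, μ = N * q - (t' - m' - (t - m)) := ⟨_, rfl⟩
    have hdiff : ∀ i, μ * v i =
        (t * v i - enteredCube v S t i) - (t' * v i - enteredCube v S' t' i) := fun i => by
      have := hwR i
      rw [hq i] at this
      push_cast at this
      rw [hμ]
      linarith
    have hnonempty : ∀ {T : Finset (Fin k)}, 0 < T.gcd v → T.Nonempty := fun {T} h => by
      rw [Finset.nonempty_iff_ne_empty]
      rintro rfl
      simp at h
    obtain ⟨a, ha⟩ := hnonempty hg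
    obtain ⟨b, hb⟩ := hnonempty hg'
    have hμ0 : μ = 0 := by
      have h1 := hdiff a
      rw [(hz a).mpr ha] at h1
      have h2 := hdiff b
      rw [(hz' b).mpr hb] at h2
      have := (he' a).1
      have := (he b).1
      nlinarith [hvR a, hvR b]
    have hSS : S = S' := by
      ext i
      rw [← hz i, ← hz' i]
      have := hdiff i
      rw [hμ0, zero_mul] at this
      rw [sub_eq_zero.mp this.symm]
    subst hSS
    have htb : 0 ≤ t ∧ t < 1 := by
      rw [ht, div_lt_one hgR]
      exact ⟨by positivity, by exact_mod_cast j.2⟩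
    have htb' : 0 ≤ t' ∧ t' < 1 := by
      rw [ht', div_lt_one hgR]
      exact ⟨by positivity, by exact_mod_cast j'.2⟩
    have htm : t' - t = ((N * q + m' - m : ℤ) : ℝ) := by
      push_cast
      linarith
    have h1 : ((N * q + m' - m : ℤ) : ℝ) < (1 : ℤ) := by
      rw [← htm]; push_cast; linarith [htb.1, htb'.2]
    have h2 : ((-1 : ℤ) : ℝ) < ((N * q + m' - m : ℤ) : ℝ) := by
      rw [← htm]; push_cast; linarith [htb.2, htb'.1]
    have h1 := Int.cast_lt.mp h1
    have h2 := Int.cast_lt.mp h2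
    have h0 : (N * q + m' - m : ℤ) = 0 := by omega
    have htt : (t : ℝ) = t' := by
      rw [h0, Int.cast_zero] at htm
      linarith
    have hjj : j = j' := by
      rw [ht, ht', div_left_inj' hgR.ne'] at htt
      exact Fin.ext (by exact_mod_cast htt)
    have hmm : m = m' := by
      have hmN : (m : ℤ) < N := by exact_mod_cast m.2
      have hmN' : (m' : ℤ) < N := by exact_mod_cast m'.2
      have hqz : q = 0 := by
        have : -1 < q := by by_contra! h; nlinarith
        have : q < 1 := by by_contra! h; nlinarith
        omega
      rw [hqz, mul_zero, zero_add] at h0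
      exact Fin.ext (by omega)
    exact hne (by rw [hjj, hmm])
  · rw [hwR i, add_sub_cancel_left, abs_le]
    have h1 := he i
    have h2 := he' i
    constructor <;> linarith [h1.1, h1.2, h2.1, h2.2]

/-- Theorem A of Malikiosis, Santos and Schymura: if the lonely runner conjecture holds
for `k - 1` speeds, then it holds for any `k` coprime distinct positive speeds whose
subset-gcd sum exceeds `(k(k+1)/2)^(k-1)`. -/
theorem lonely_runner_gcd_sum_bound (k : ℕ) (hk : 2 ≤ k)
    (H : ∀ u : Fin (k - 1) → ℕ, (∀ i, 0 < u i) → Function.Injective u →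
      ∃ t : ℝ, ∀ i, nearestDist (t * u i) ≥ 1 / k)
    (v : Fin k → ℕ) (hpos : ∀ i, 0 < v i) (hinj : Function.Injective v)
    (hgcd : Finset.univ.gcd v = 1)
    (hsum : ∑ S ∈ (Finset.univ : Finset (Fin k)).powerset, S.gcd v
      > (k * (k + 1) / 2) ^ (k - 1)) :
    ∃ t : ℝ, ∀ i, nearestDist (t * v i) ≥ 1 / (k + 1) := by
  have hk0 : 0 < k := by omega
  have hkR : (0 : ℝ) < k := by exact_mod_cast hk0
  set N := k * (k + 1) / 2
  have h2N : 2 * N = k * (k + 1) := Nat.mul_div_cancel' (Nat.even_mul_succ_self k).two_dvd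
  have hN : 0 < N := by
    have : 0 < k * (k + 1) := by positivity
    omega
  have hNR : (0 : ℝ) < N := by exact_mod_cast hN
  have h2NR : 2 * (N : ℝ) = k * (k + 1) := by exact_mod_cast h2N
  rw [Finset.powerset_univ] at hsum
  obtain ⟨w, c, ⟨a, b, hab⟩, hw⟩ := exists_close_to_line_of_gcd_sum hk0 hN hpos hgcd hsum
  obtain ⟨i, j, hij, hne⟩ := exists_mediant_ne (v := fun l => (v l : ℤ))
    (fun l => by exact_mod_cast hpos l) hab
  obtain ⟨τ, hτ⟩ := exists_lonely_time_of_natAbs_eq H _ hne hij (by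
    rw [← Int.natAbs_neg]
    congr 1
    ring)
  obtain ⟨β, hβ⟩ : ∃ β : ℝ, β = -(τ * (v i + v j)) := ⟨_, rfl⟩
  refine ⟨τ * (w i + w j) + (β - round β) * (c / N), fun l => le_nearestDist_iff.mpr fun n => ?_⟩
  have h1 := hτ l (round β * w l + n)
  have hround : |β - round β| ≤ 1 / 2 := abs_sub_round β
  have herr : |(β - round β) * (w l - c / N * v l)| ≤ 1 / (k * (k + 1)) := by
    have : (w l : ℝ) - c / N * v l = (N * w l - c * v l) / N := by field_simp
    rw [this, abs_mul, abs_div, abs_of_pos hNR]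
    calc |β - round β| * (|N * (w l : ℝ) - c * v l| / N) ≤ 1 / 2 * (1 / N) := by
          gcongr
          exact hw l
      _ = 1 / (k * (k + 1)) := by rw [← h2NR]; field_simp
  have hsplit : τ * (((w i + w j) * v l - (v i + v j) * w l : ℤ) : ℝ) -
      ((round β * w l + n : ℤ) : ℝ) =
      ((τ * (w i + w j) + (β - round β) * (c / N)) * v l - n) +
        (β - round β) * (w l - c / N * v l) := by
    push_cast
    linear_combination (-(w l : ℝ)) * hβ
  rw [hsplit] at h1
  have h3 := abs_add_le ((τ * (w i + w j) + (β - round β) * (c / N)) * v l - n)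
    ((β - round β) * (w l - c / N * v l))
  have h4 : 1 / (k : ℝ) - 1 / (k * (k + 1)) = 1 / (k + 1) := by
    field_simp
    ring
  linarith
end

section
/- Let k ≥ 2 be an integer. Suppose that for every set of k−1 distinct positive integers u₁, …, u_{k−1} there exists a real number t with ‖t·uᵢ‖ ≥ 1/k for all i. Let v₁, …, v_k be distinct positive integers with gcd(v₁, …, v_k) = 1 such that the product v₁·v₂·⋯·v_k is at least [ (k(k+1)/2)^{k−1} / k ]^k. Then there exists a real number t such that ‖t·vᵢ‖ ≥ 1/(k+1) for all i ∈ {1, …, k}. -/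
theorem nearestDist_neg (x : ℝ) : nearestDist (-x) = nearestDist x := by
  have key : ∀ y : ℝ, nearestDist y ≤ nearestDist (-y) := fun y => by
    rw [le_nearestDist_iff]
    intro n
    have h := le_nearestDist_iff.1 (le_refl (nearestDist y)) (-n)
    rw [← abs_neg]
    convert h using 2
    push_cast
    ring
  exact le_antisymm (by simpa using key (-x)) (key x)

theorem nearestDist_mul_natAbs (t : ℝ) (m : ℤ) :
    nearestDist (t * m.natAbs) = nearestDist (t * m) := by
  rw [Nat.cast_natAbs, Int.cast_abs]
  rcases abs_choice (m : ℝ) with h | h <;> rw [h]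
  rw [mul_neg, nearestDist_neg]

/-- An integer dividing `m * v l` for all `l`, with `v` coprime, divides `m`. -/
theorem Int.dvd_of_forall_dvd_mul_of_gcd_eq_one {ι : Type*} [Fintype ι] {v : ι → ℕ}
    (hgcd : Finset.univ.gcd v = 1) {d m : ℤ} (h : ∀ l, d ∣ m * v l) : d ∣ m := by
  have h1 : d.natAbs ∣ Finset.univ.gcd fun l => m.natAbs * v l :=
    Finset.dvd_gcd fun l _ => by simpa [Int.natAbs_mul] using Int.natAbs_dvd_natAbs.2 (h l)
  rw [Finset.gcd_mul_left, hgcd] at h1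
  exact Int.natAbs_dvd_natAbs.1 (by simpa using h1)

/-- An integer vector parallel to a coprime positive vector is an integer multiple of it. -/
theorem exists_eq_mul_of_parallel {ι : Type*} [Fintype ι] [Nonempty ι] {v : ι → ℕ}
    (hpos : ∀ i, 0 < v i) (hgcd : Finset.univ.gcd v = 1) {w : ι → ℤ}
    (h : ∀ i j, w i * v j = w j * v i) : ∃ q : ℤ, ∀ i, w i = q * v i := by
  obtain ⟨j⟩ := ‹Nonempty ι›
  obtain ⟨q, hq⟩ : (v j : ℤ) ∣ w j :=
    Int.dvd_of_forall_dvd_mul_of_gcd_eq_one hgcd fun i => ⟨w i, by rw [← h i j]; ring⟩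
  refine ⟨q, fun i => ?_⟩
  have hj : (v j : ℤ) ≠ 0 := by exact_mod_cast (hpos j).ne'
  apply mul_right_cancel₀ hj
  rw [h i j, hq]
  ring

/-- The integer vector counting, for each `l`, the pairs `(s', l)` with `s' * v l` a natural
number that precede `(s, i)` lexicographically. It lies in the unit cube attached to `s • v`. -/
def staircase {ι : Type*} [LinearOrder ι] (v : ι → ℕ) (s : ℚ) (i l : ι) : ℤ :=
  if l < i then ⌊s * v l⌋ + 1 else ⌈s * v l⌉

section staircase

variable {ι : Type*} [LinearOrder ι] (v : ι → ℕ)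

theorem le_staircase (s : ℚ) (i l : ι) : s * v l ≤ staircase v s i l := by
  unfold staircase
  split_ifs
  · push_cast
    exact (Int.lt_floor_add_one _).le
  · exact Int.le_ceil _

theorem staircase_le (s : ℚ) (i l : ι) : (staircase v s i l : ℚ) ≤ s * v l + 1 := by
  unfold staircase
  split_ifs
  · push_cast
    gcongr
    exact Int.floor_le _
  · exact (Int.ceil_lt_add_one _).le

theorem staircase_self {s : ℚ} {i : ι} {j : ℕ} (h : s * v i = j) : staircase v s i i = j := by
  simp [staircase, h]

theorem staircase_sub_ne {s s' : ℚ} {i i' : ι} {j j' : ℕ} (h : s * v i = j)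
    (h' : s' * v i' = j') (hj' : j' < v i') (hs : 0 ≤ s) (hlt : s < s' ∨ s = s' ∧ i < i')
    (hi : 0 < v i) (c : ℤ) : ¬ ∀ l, staircase v s' i' l - staircase v s i l = c * v l := by
  intro hc
  have h1 : (j : ℤ) < staircase v s' i' i := by
    rcases hlt with hlt | ⟨rfl, hlt⟩
    · have := le_staircase v s' i' i
      have h2 : s * v i < s' * v i := by gcongr
      rw [h] at h2
      exact_mod_cast h2.trans_le this
    · simp [staircase, hlt, h]
  have h2 : 0 ≤ staircase v s i i' := by
    have := (mul_nonneg hs (Nat.cast_nonneg (v i'))).trans (le_staircase v s i i')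
    exact_mod_cast this
  have h3 := hc i
  have h4 := hc i'
  rw [staircase_self v h] at h3
  rw [staircase_self v h'] at h4
  have hc0 : 0 < c := by
    by_contra! hn
    nlinarith [mul_nonneg (neg_nonneg.2 hn) (Nat.cast_nonneg (α := ℤ) (v i))]
  have hv : (j' : ℤ) < v i' := by exact_mod_cast hj'
  nlinarith [Nat.cast_nonneg (α := ℤ) (v i')]

theorem staircase_sub_ne_of_ne (hpos : ∀ i, 0 < v i) {p q : Σ i, Fin (v i)} (hpq : p ≠ q)
    (c : ℤ) : ¬ ∀ l, staircase v ((p.2 : ℚ) / v p.1) p.1 l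
      - staircase v ((q.2 : ℚ) / v q.1) q.1 l = c * v l := by
  have hv : ∀ r : Σ i, Fin (v i), ((r.2 : ℚ) / v r.1) * v r.1 = ((r.2 : ℕ) : ℚ) := fun r =>
    div_mul_cancel₀ _ (by exact_mod_cast (hpos r.1).ne')
  have h0 : ∀ r : Σ i, Fin (v i), 0 ≤ ((r.2 : ℚ) / v r.1) := fun r => by positivity
  have key : ∀ p q : Σ i, Fin (v i), ∀ c : ℤ,
      ((q.2 : ℚ) / v q.1 < (p.2 : ℚ) / v p.1 ∨
        (q.2 : ℚ) / v q.1 = (p.2 : ℚ) / v p.1 ∧ q.1 < p.1) →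
      ¬ ∀ l, staircase v ((p.2 : ℚ) / v p.1) p.1 l
        - staircase v ((q.2 : ℚ) / v q.1) q.1 l = c * v l := fun p q c hlt =>
    staircase_sub_ne v (hv q) (hv p) p.2.isLt (h0 q) hlt (hpos _) c
  rcases lt_trichotomy ((q.2 : ℚ) / v q.1) ((p.2 : ℚ) / v p.1) with hs | hs | hs
  · exact key p q c (.inl hs)
  · rcases lt_trichotomy q.1 p.1 with hi | hi | hi
    · exact key p q c (.inr ⟨hs, hi⟩)
    · exfalso
      apply hpq
      obtain ⟨i, a⟩ := p
      obtain ⟨i', b⟩ := q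
      obtain rfl : i' = i := hi
      have ha := hv ⟨i', a⟩
      have hb := hv ⟨i', b⟩
      rw [← hs, hb] at ha
      congr
      exact Fin.ext (by exact_mod_cast ha.symm)
    · intro hc
      exact key q p (-c) (.inr ⟨hs.symm, hi⟩) fun l => by linarith [hc l]
  · intro hc
    exact key q p (-c) (.inl hs) fun l => by linarith [hc l]

end staircase

/-- If the sum of the coprime positive integers `v i` exceeds `N ^ (card ι - 1)`, then some
multiple of `v` is within `1 / N` of an integer vector that is not parallel to `v`. -/
theorem exists_near_integer_not_parallel {ι : Type*} [Fintype ι] [LinearOrder ι] [Nonempty ι]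
    {v : ι → ℕ} (hpos : ∀ i, 0 < v i) (hgcd : Finset.univ.gcd v = 1) {N : ℕ} (hN : 0 < N)
    (hsum : N ^ Fintype.card ι < (∑ i, v i) * N) :
    ∃ (w : ι → ℤ) (t : ℝ), (∀ l, N * |t * v l - w l| ≤ 1) ∧
      ¬ ∀ i j, w i * v j = w j * v i := by
  have : NeZero N := ⟨hN.ne'⟩
  let z : (Σ i, Fin (v i)) → ι → ℤ := fun p => staircase v ((p.2 : ℚ) / v p.1) p.1
  let f : (Σ i, Fin (v i)) × Fin N → ι → ZMod N :=
    fun x l => ((z x.1 l + (x.2 : ℕ) * v l : ℤ) : ZMod N)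
  obtain ⟨⟨p, c⟩, ⟨q, d⟩, hne, hf⟩ : ∃ x y, x ≠ y ∧ f x = f y := by
    apply Fintype.exists_ne_map_eq_of_card_lt
    simpa [ZMod.card] using hsum
  have hdvd : ∀ l, (N : ℤ) ∣ (z p l + (c : ℕ) * v l) - (z q l + (d : ℕ) * v l) := fun l =>
    (ZMod.intCast_eq_intCast_iff_dvd_sub _ _ _).1 (congrFun hf l).symm
  have hpq : p ≠ q := by
    rintro rfl
    have hcd : (N : ℤ) ∣ (c : ℕ) - (d : ℕ) :=
      Int.dvd_of_forall_dvd_mul_of_gcd_eq_one hgcd fun l => by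
        convert hdvd l using 1
        ring
    have hc := c.isLt
    have hd := d.isLt
    have h0 := Int.eq_zero_of_abs_lt_dvd hcd (by rw [abs_lt]; constructor <;> omega)
    exact hne (Prod.ext rfl (Fin.ext (by simp only; omega)))
  choose w hw using hdvd
  have hNR : (0 : ℝ) < N := by exact_mod_cast hN
  refine ⟨w, (((p.2 : ℚ) / v p.1 - (q.2 : ℚ) / v q.1 : ℚ) + ((c : ℕ) : ℝ) - ((d : ℕ) : ℝ)) / N,
    fun l => ?_, fun hpar => ?_⟩
  · have hwl : (z p l + (c : ℕ) * v l) - (z q l + (d : ℕ) * v l) = (N * w l : ℝ) := by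
      exact_mod_cast hw l
    have cast_le : ∀ {a b : ℚ}, a ≤ b → (a : ℝ) ≤ b := fun h => by exact_mod_cast h
    have h1 := cast_le (le_staircase v ((p.2 : ℚ) / v p.1) p.1 l)
    have h2 := cast_le (staircase_le v ((p.2 : ℚ) / v p.1) p.1 l)
    have h3 := cast_le (le_staircase v ((q.2 : ℚ) / v q.1) q.1 l)
    have h4 := cast_le (staircase_le v ((q.2 : ℚ) / v q.1) q.1 l)
    rw [← abs_of_pos hNR, ← abs_mul, abs_of_pos hNR, mul_sub, ← hwl, ← mul_assoc,
      mul_div_cancel₀ _ hNR.ne']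
    push_cast at h1 h2 h3 h4 ⊢
    simp only [z]
    rw [abs_le]
    constructor <;> linarith
  · obtain ⟨m, hm⟩ := exists_eq_mul_of_parallel hpos hgcd hpar
    apply staircase_sub_ne_of_ne v hpos hpq (N * m - (c : ℕ) + (d : ℕ))
    intro l
    have := hw l
    rw [hm l] at this
    simp only [z] at this
    linear_combination this

/-- If `w` is not parallel to the positive vector `v`, there are `i ≠ j` such that the
combination of `v` and `w` taking opposite values at `i` and `j` vanishes nowhere. -/
theorem exists_pair_combination_ne_zero {ι : Type*} [Fintype ι] {v : ι → ℕ}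
    (hpos : ∀ i, 0 < v i) {w : ι → ℤ} (h : ¬ ∀ i j, w i * v j = w j * v i) :
    ∃ i j, i ≠ j ∧ ∀ l, (w i + w j) * v l - (v i + v j) * w l ≠ 0 := by
  have hv : ∀ i, (0 : ℚ) < v i := fun i => by exact_mod_cast hpos i
  push Not at h
  obtain ⟨a, b, hab⟩ := h
  let r : ι → ℚ := fun i => w i / v i
  have hr : ∀ i, r i * v i = w i := fun i => div_mul_cancel₀ _ (hv i).ne'
  have hrab : r a ≠ r b := by
    intro he
    apply hab
    have : (w a * v b : ℚ) = w b * v a := by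
      rw [← hr a, ← hr b, he]
      ring
    exact_mod_cast this
  obtain ⟨i, -, hi⟩ := Finset.exists_min_image Finset.univ r ⟨a, Finset.mem_univ a⟩
  have hne : (Finset.univ.filter fun l => r i < r l).Nonempty := by
    rcases (hi a (Finset.mem_univ a)).lt_or_eq with h | h
    · exact ⟨a, by simpa using h⟩
    · exact ⟨b, by simpa using (hi b (Finset.mem_univ b)).lt_of_ne (h ▸ hrab)⟩
  obtain ⟨j, hj, hjmin⟩ := Finset.exists_min_image _ r hne
  replace hj : r i < r j := by simpa using hj
  refine ⟨i, j, fun he => hj.ne (he ▸ rfl), fun l hl => ?_⟩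
  have hl' : ((w i + w j) * v l - (v i + v j) * w l : ℚ) = 0 := by exact_mod_cast hl
  rw [← hr i, ← hr j, ← hr l] at hl'
  have hl'' : v i * (r i - r l) + v j * (r j - r l) = 0 := by
    apply mul_right_cancel₀ (hv l).ne'
    linear_combination hl'
  rcases (hi l (Finset.mem_univ l)).lt_or_eq with h | h
  · have := hjmin l (by simpa using h)
    nlinarith [mul_pos (hv i) (sub_pos.2 h), mul_nonneg (hv j).le (sub_nonneg.2 this)]
  · rw [← h] at hl''
    nlinarith [mul_pos (hv j) (sub_pos.2 hj)]

/-- The lonely runner property for `n` speeds extends to any family of positive speeds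
taking at most `n` values. -/
theorem exists_forall_le_nearestDist_of_card_le {n : ℕ} {c : ℝ}
    (H : ∀ u : Fin n → ℕ, (∀ i, 0 < u i) → Function.Injective u →
      ∃ t : ℝ, ∀ i, nearestDist (t * u i) ≥ c)
    (s : Finset ℕ) (hs : ∀ a ∈ s, 0 < a) (hcard : s.card ≤ n) :
    ∃ t : ℝ, ∀ a ∈ s, c ≤ nearestDist (t * a) := by
  have : Infinite {a : ℕ // 0 < a} := inferInstanceAs (Infinite ℕ+)
  obtain ⟨S, hS, hSc⟩ := Infinite.exists_superset_card_eq (s.subtype (0 < ·)) n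
    ((Finset.card_subtype _ _).trans_le ((Finset.card_filter_le _ _).trans hcard))
  obtain ⟨t, ht⟩ := H (fun i => ((S.equivFinOfCardEq hSc).symm i : {a : ℕ // 0 < a}))
    (fun i => Subtype.prop _)
    (Subtype.val_injective.comp (Subtype.val_injective.comp (Equiv.injective _)))
  refine ⟨t, fun a ha => ?_⟩
  have hmem : (⟨a, hs a ha⟩ : {a : ℕ // 0 < a}) ∈ S := hS (by simpa using ha)
  simpa using ht (S.equivFinOfCardEq hSc ⟨_, hmem⟩)

/-- The strict inequality of arithmetic and geometric means for distinct positive integers. -/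
theorem prod_lt_sum_div_pow {k : ℕ} (hk : 2 ≤ k) {v : Fin k → ℕ} (hpos : ∀ i, 0 < v i)
    (hinj : Function.Injective v) :
    ((∏ i, v i : ℕ) : ℝ) < ((∑ i, v i : ℕ) / k : ℝ) ^ k := by
  have hk0 : (0 : ℝ) < k := by exact_mod_cast (by omega : 0 < k)
  have hv : ∀ i, (0 : ℝ) < v i := fun i => by exact_mod_cast hpos i
  have hne : (⟨0, by omega⟩ : Fin k) ≠ ⟨1, by omega⟩ := by simp
  have h := strictConcaveOn_log_Ioi.lt_map_sum (t := Finset.univ) (w := fun _ : Fin k => (k : ℝ)⁻¹)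
    (p := fun i => (v i : ℝ)) (fun _ _ => by positivity) (by simp [hk0.ne'])
    (fun i _ => hv i) ⟨_, Finset.mem_univ _, _, Finset.mem_univ _,
      fun he => hne (hinj (by exact_mod_cast he))⟩
  simp only [smul_eq_mul, ← Finset.mul_sum] at h
  have hsum : (0 : ℝ) < ∑ i, (v i : ℝ) :=
    Finset.sum_pos (fun i _ => hv i) ⟨⟨0, by omega⟩, Finset.mem_univ _⟩
  push_cast
  rw [← Real.log_lt_log_iff (Finset.prod_pos fun i _ => hv i) (by positivity), Real.log_pow,
    Real.log_prod fun i _ => (hv i).ne', div_eq_inv_mul]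
  rwa [inv_mul_lt_iff₀ hk0] at h

/-- Corollary of Theorem A of Malikiosis, Santos and Schymura: if the lonely runner
conjecture holds for `k - 1` speeds, then it holds for any `k` coprime distinct positive
speeds whose product is at least `((k(k+1)/2)^(k-1) / k)^k`. -/
theorem lonely_runner_product_bound (k : ℕ) (hk : 2 ≤ k)
    (H : ∀ u : Fin (k - 1) → ℕ, (∀ i, 0 < u i) → Function.Injective u →
      ∃ t : ℝ, ∀ i, nearestDist (t * u i) ≥ 1 / k)
    (v : Fin k → ℕ) (hpos : ∀ i, 0 < v i) (hinj : Function.Injective v)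
    (hgcd : Finset.univ.gcd v = 1)
    (hprod : ((∏ i, v i : ℕ) : ℝ)
      ≥ (((k : ℝ) * (k + 1) / 2) ^ (k - 1) / k) ^ k) :
    ∃ t : ℝ, ∀ i, nearestDist (t * v i) ≥ 1 / (k + 1) := by
  have hk0 : (0 : ℝ) < k := by exact_mod_cast (by omega : 0 < k)
  have : Nonempty (Fin k) := ⟨⟨0, by omega⟩⟩
  obtain ⟨N, hN⟩ : ∃ N, k * (k + 1) = N + N := Nat.even_mul_succ_self k
  have hNR : (k : ℝ) * (k + 1) / 2 = N := by
    have : (k : ℝ) * (k + 1) = N + N := by exact_mod_cast hN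
    linarith
  have hN0 : 0 < N := by
    have : 0 < k * (k + 1) := by positivity
    omega
  have hN0' : (0 : ℝ) < N := by exact_mod_cast hN0
  have hsum : N ^ (k - 1) < ∑ i, v i := by
    have h := hprod.le.trans_lt (prod_lt_sum_div_pow hk hpos hinj)
    rw [hNR] at h
    have h' := (div_lt_div_iff_of_pos_right hk0).1 (lt_of_pow_lt_pow_left₀ k (by positivity) h)
    exact_mod_cast h'
  obtain ⟨w, t₀, hw, hpar⟩ := exists_near_integer_not_parallel hpos hgcd hN0 (by
    rw [Fintype.card_fin]
    calc N ^ k = N ^ (k - 1) * N := by rw [← pow_succ]; congr 1; omega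
      _ < (∑ i, v i) * N := Nat.mul_lt_mul_of_pos_right hsum hN0)
  obtain ⟨i, j, hij, hu⟩ := exists_pair_combination_ne_zero hpos hpar
  let u : Fin k → ℤ := fun l => (w i + w j) * v l - (v i + v j) * w l
  have huij : (u j).natAbs = (u i).natAbs := by
    rw [Int.natAbs_eq_natAbs_iff]
    right
    simp only [u]
    ring
  obtain ⟨t, ht⟩ := exists_forall_le_nearestDist_of_card_le H
    (Finset.univ.image fun l => (u l).natAbs)
    (by simpa [Nat.pos_iff_ne_zero] using hu) (by
      have hsub : (Finset.univ.image fun l => (u l).natAbs) ⊆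
          (Finset.univ.erase j).image fun l => (u l).natAbs := by
        intro a ha
        obtain ⟨l, -, rfl⟩ := Finset.mem_image.1 ha
        by_cases hl : l = j
        · exact Finset.mem_image.2 ⟨i, by simpa using hij, by rw [hl, huij]⟩
        · exact Finset.mem_image.2 ⟨l, by simpa using hl, rfl⟩
      simpa using (Finset.card_le_card hsub).trans Finset.card_image_le)
  let M : ℝ := t * (v i + v j)
  refine ⟨t * (w i + w j) - (M - round M) * t₀, fun l => le_nearestDist_iff.2 fun n => ?_⟩
  have h1 := ht _ (Finset.mem_image_of_mem _ (Finset.mem_univ l))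
  rw [nearestDist_mul_natAbs, le_nearestDist_iff] at h1
  have h2 := h1 (n - round M * w l)
  have hr : |M - round M| ≤ 1 / 2 := abs_sub_round M
  have herr : |(M - round M) * (t₀ * v l - w l)| ≤ 1 / (k * (k + 1)) := by
    rw [abs_mul]
    have hb : |t₀ * v l - w l| ≤ 1 / N := by
      rw [le_div_iff₀ hN0', mul_comm]
      exact hw l
    calc _ ≤ (1 / 2 : ℝ) * (1 / N) := by gcongr
      _ = 1 / (k * (k + 1)) := by
        rw [← hNR]
        field_simp
  have hsplit : t * (u l : ℝ) - ((n - round M * w l : ℤ) : ℝ) =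
      ((t * (w i + w j) - (M - round M) * t₀) * v l - n)
        + (M - round M) * (t₀ * v l - w l) := by
    simp only [u, M]
    push_cast
    ring
  rw [hsplit] at h2
  have hfrac : (1 : ℝ) / k - 1 / (k * (k + 1)) = 1 / (k + 1) := by
    field_simp
    ring
  linarith [abs_add_le ((t * (w i + w j) - (M - round M) * t₀) * v l - n)
    ((M - round M) * (t₀ * v l - w l))]
end

section
/- Let k ≥ 1 be an integer and let v₁, …, v_k be k distinct positive integers such that there is no real number t with ‖t·vᵢ‖ ≥ 1/(k+1) for all i ∈ {1, …, k}. Then lcm(2, 3, …, k+1) divides the product v₁·v₂·⋯·v_k. -/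
theorem one_div_le_nearestDist_div {q m : ℕ} (hq : 0 < q) (h : ¬ q ∣ m) :
    1 / (q : ℝ) ≤ nearestDist (1 / q * m) := by
  have hq' : (0 : ℝ) < q := by exact_mod_cast hq
  refine le_ciInf fun n => ?_
  have hne : (m : ℤ) - n * q ≠ 0 := fun h0 =>
    h (Int.natCast_dvd_natCast.mp ⟨n, by linarith [mul_comm n (q : ℤ)]⟩)
  have habs : (1 : ℝ) ≤ |(m : ℝ) - n * q| := by exact_mod_cast Int.one_le_abs hne
  have heq : 1 / (q : ℝ) * m - n = (m - n * q) / q := by field_simp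
  rw [heq, abs_div, abs_of_pos hq']
  gcongr

/-- If a set of `k` distinct positive integers does not have the lonely runner property,
then `lcm(2, 3, …, k+1)` divides the product of its elements. -/
theorem lcm_dvd_prod_of_not_LR (k : ℕ) (hk : 1 ≤ k)
    (v : Fin k → ℕ) (hpos : ∀ i, 0 < v i) (hinj : Function.Injective v)
    (hnoLR : ¬ ∃ t : ℝ, ∀ i, nearestDist (t * v i) ≥ 1 / (k + 1)) :
    (Finset.Icc 2 (k + 1)).lcm id ∣ ∏ i, v i := by
  refine Finset.lcm_dvd fun q hq => ?_
  obtain ⟨hq2, hqk⟩ := Finset.mem_Icc.mp hq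
  have hq0 : 0 < q := by omega
  obtain ⟨i, hi⟩ : ∃ i, q ∣ v i := by
    by_contra! hndvd
    refine hnoLR ⟨1 / q, fun i => le_trans ?_ (one_div_le_nearestDist_div hq0 (hndvd i))⟩
    exact one_div_le_one_div_of_le (by exact_mod_cast hq0) (by exact_mod_cast hqk)
  exact hi.trans (Finset.dvd_prod_of_mem v (Finset.mem_univ i))
end

section
/- Let k ≥ 3 be an integer. Suppose that for every set of k−1 distinct positive integers u₁, …, u_{k−1} there exists a real number t with ‖t·uᵢ‖ ≥ 1/k for all i. Let v₁, …, v_k be distinct positive integers with gcd(v₁, …, v_k) = 1 but gcd(v₁, …, v_{k−1}) ≠ 1. Then there exists a real number t such that ‖t·vᵢ‖ ≥ 1/(k+1) for all i ∈ {1, …, k}. -/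
theorem nearestDist_add_intCast (x : ℝ) (m : ℤ) : nearestDist (x + m) = nearestDist x :=
  (Equiv.addRight m).symm.iInf_congr fun n => by
    simp only [Equiv.addRight_symm, Equiv.coe_addRight]
    push_cast
    congr 1
    ring

theorem le_nearestDist {c x : ℝ} (h₀ : c ≤ x) (h₁ : x ≤ 1 - c) : c ≤ nearestDist x := by
  refine le_nearestDist_iff.2 fun n => ?_
  rcases le_or_gt n 0 with hn | hn
  · have : (n : ℝ) ≤ 0 := by exact_mod_cast hn
    exact le_trans (by linarith) (le_abs_self _)
  · have : (1 : ℝ) ≤ n := by exact_mod_cast hn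
    exact le_trans (by linarith) (neg_le_abs _)

/-- Among the translates of `x` by multiples of `1 / d`, with `d ≥ 2`, one is at distance at least
`1 / 4` from the integers. -/
theorem exists_quarter_le_nearestDist_add_div {d : ℕ} (hd : 2 ≤ d) (x : ℝ) :
    ∃ m : ℤ, 1 / 4 ≤ nearestDist (x + m / d) := by
  have hd' : (2 : ℝ) ≤ d := by exact_mod_cast hd
  have hd₀ : (0 : ℝ) < d := by linarith
  have h₁ := Int.le_ceil ((1 / 4 - x) * d)
  have h₂ := Int.ceil_lt_add_one ((1 / 4 - x) * d)
  refine ⟨⌈(1 / 4 - x) * d⌉, le_nearestDist ?_ ?_⟩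
  · have := (le_div_iff₀ hd₀).2 h₁
    linarith
  · have : (⌈(1 / 4 - x) * d⌉ : ℝ) / d ≤ 3 / 4 - x := by
      rw [div_le_iff₀ hd₀]
      linarith
    linarith

/-- Shifting time by a multiple of `1 / d` moves a runner whose speed is coprime to `d` to a
distance at least `1 / 4` from the integers. -/
theorem exists_quarter_le_nearestDist_shift {d w : ℕ} (hd : 2 ≤ d) (h : Nat.Coprime d w) (t : ℝ) :
    ∃ j : ℤ, 1 / 4 ≤ nearestDist ((t + j / d) * w) := by
  obtain ⟨m, hm⟩ := exists_quarter_le_nearestDist_add_div hd (t * w)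
  obtain ⟨a, b, hab⟩ := Nat.isCoprime_iff_coprime.2 h
  have hab' : (a : ℝ) * d + b * w = 1 := by exact_mod_cast hab
  have hd₀ : (d : ℝ) ≠ 0 := by
    have : d ≠ 0 := by omega
    exact_mod_cast this
  refine ⟨m * b, ?_⟩
  rw [← nearestDist_add_intCast _ (m * a)]
  convert hm using 2
  push_cast
  field_simp
  linear_combination (m : ℝ) * hab'

theorem nearestDist_shift_of_dvd {d w : ℕ} (hd : d ≠ 0) (h : d ∣ w) (t : ℝ) (j : ℤ) :
    nearestDist ((t + j / d) * w) = nearestDist (t * w) := by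
  obtain ⟨c, rfl⟩ := h
  have hd₀ : (d : ℝ) ≠ 0 := by exact_mod_cast hd
  rw [← nearestDist_add_intCast (t * _) (j * c)]
  congr 1
  push_cast
  field_simp

/-- If the lonely runner conjecture holds for `k - 1` speeds (`k ≥ 3`), and
`v₁, …, v_k` are distinct positive integers with `gcd(v₁, …, v_k) = 1` but
`gcd(v₁, …, v_{k-1}) ≠ 1`, then `v₁, …, v_k` has the lonely runner property. -/
theorem LR_of_gcd_first_speeds (k : ℕ) (hk : 3 ≤ k)
    (H : ∀ u : Fin (k - 1) → ℕ, (∀ i, 0 < u i) → Function.Injective u →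
      ∃ t : ℝ, ∀ i, nearestDist (t * u i) ≥ 1 / k)
    (v : Fin k → ℕ) (hpos : ∀ i, 0 < v i) (hinj : Function.Injective v)
    (hgcd : Finset.univ.gcd v = 1)
    (hgcd' : (Finset.univ.filter (fun i : Fin k => (i : ℕ) < k - 1)).gcd v ≠ 1) :
    ∃ t : ℝ, ∀ i, nearestDist (t * v i) ≥ 1 / (k + 1) := by
  set d := (Finset.univ.filter (fun i : Fin k => (i : ℕ) < k - 1)).gcd v
  have hdvd (i : Fin k) (hi : (i : ℕ) < k - 1) : d ∣ v i :=
    Finset.gcd_dvd (by simpa using hi)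
  have hd₀ : d ≠ 0 := by
    intro h
    have h₁ := hdvd ⟨0, by omega⟩ (by simp only; omega)
    rw [h, zero_dvd_iff] at h₁
    exact (hpos _).ne' h₁
  have hlast (i : Fin k) (hi : ¬ (i : ℕ) < k - 1) : i = ⟨k - 1, by omega⟩ :=
    Fin.ext (by simp only; omega)
  have hcop : Nat.Coprime d (v ⟨k - 1, by omega⟩) := by
    refine Nat.dvd_one.1 ((Finset.dvd_gcd fun i _ => ?_).trans hgcd.dvd)
    by_cases hi : (i : ℕ) < k - 1
    · exact (Nat.gcd_dvd_left _ _).trans (hdvd i hi)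
    · rw [hlast i hi]
      exact Nat.gcd_dvd_right _ _
  obtain ⟨t, ht⟩ := H (fun i => v (i.castLE (Nat.sub_le k 1))) (fun _ => hpos _)
    (hinj.comp (Fin.castLE_injective (Nat.sub_le k 1)))
  obtain ⟨j, hj⟩ := exists_quarter_le_nearestDist_shift (by omega) hcop t
  have hk' : (3 : ℝ) ≤ k := by exact_mod_cast hk
  refine ⟨t + j / d, fun i => ?_⟩
  by_cases hi : (i : ℕ) < k - 1
  · rw [nearestDist_shift_of_dvd hd₀ (hdvd i hi)]
    exact (one_div_le_one_div_of_le (by linarith) (by linarith)).trans (ht ⟨i, hi⟩)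
  · rw [hlast i hi]
    exact (one_div_le_one_div_of_le (by norm_num) (by linarith)).trans hj
end

section
/- Let k ≥ 3 be an integer. Suppose that for every set of k−1 distinct positive integers u₁, …, u_{k−1} there exists a real number t with ‖t·uᵢ‖ ≥ 1/k for all i. Let p be a positive integer with the following property: for all v₁, …, v_k ∈ {0, 1, …, (k+1)p − 1} such that (i) for every subset S of {v₁, …, v_k} of size k−1 one has gcd(S ∪ {(k+1)p}) = 1, and (ii) no vᵢ is divisible by p, there exists an integer t ∈ {0, 1, …, (k+1)p − 1} with ‖t·vᵢ/((k+1)p)‖ ≥ 1/(k+1) for all i. Then for every set {w₁, …, w_k} of k distinct positive integers for which there is no real t with ‖t·wᵢ‖ ≥ 1/(k+1) for all i, the prime-candidate p divides the product w₁·w₂·⋯·w_k. -/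
theorem exists_add_int_div_le_nearestDist (x : ℝ) {g : ℕ} (hg : 2 ≤ g) :
    ∃ n : ℤ, 1 / 4 ≤ nearestDist (x + n / g) := by
  have hg2 : (2 : ℝ) ≤ g := by exact_mod_cast hg
  have hg0 : (0 : ℝ) < g := by linarith
  refine ⟨⌈(1 / 4 - x) * g⌉, le_nearestDist_iff.2 fun n => ?_⟩
  have hlow : 1 / 4 - x ≤ (⌈(1 / 4 - x) * g⌉ : ℝ) / g :=
    (le_div_iff₀ hg0).2 (Int.le_ceil _)
  have hupp : (⌈(1 / 4 - x) * g⌉ : ℝ) / g ≤ 3 / 4 - x := by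
    rw [div_le_iff₀ hg0]
    nlinarith [Int.ceil_lt_add_one ((1 / 4 - x) * g)]
  rcases le_or_gt n 0 with hn | hn
  · have : (n : ℝ) ≤ 0 := by exact_mod_cast hn
    exact le_abs.2 (Or.inl (by linarith))
  · have : (1 : ℝ) ≤ n := by exact_mod_cast hn
    exact le_abs.2 (Or.inr (by linarith))

/-- If `g ≥ 2` is coprime to `a`, some shift of the time `t` by a multiple of `1 / g` takes the
runner of speed `a` far from the origin. -/
theorem exists_shift_le_nearestDist (t : ℝ) {a g : ℕ} (hg : 2 ≤ g) (hga : g.Coprime a) :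
    ∃ m : ℤ, 1 / 4 ≤ nearestDist ((t + m / g) * a) := by
  obtain ⟨n, hn⟩ := exists_add_int_div_le_nearestDist (t * a) hg
  have hg0 : (g : ℝ) ≠ 0 := by positivity
  have bezout : (1 : ℝ) = g * Nat.gcdA g a + a * Nat.gcdB g a := by
    have h := Nat.gcd_eq_gcd_ab g a
    rw [hga] at h
    exact_mod_cast h
  refine ⟨n * Nat.gcdB g a, ?_⟩
  rw [← nearestDist_add_intCast _ (n * Nat.gcdA g a)]
  convert hn using 2
  push_cast
  field_simp
  linear_combination -(n : ℝ) * bezout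

/-- In a counterexample with coprime speeds, any `k - 1` of the speeds are already coprime. -/
theorem gcd_eq_one_of_not_lonely {k : ℕ} (hk : 3 ≤ k)
    (H : ∀ u : Fin (k - 1) → ℕ, (∀ i, 0 < u i) → Function.Injective u →
      ∃ t : ℝ, ∀ i, nearestDist (t * u i) ≥ 1 / k)
    {w : Fin k → ℕ} (hpos : ∀ i, 0 < w i) (hinj : Function.Injective w)
    (hnoLR : ¬ ∃ t : ℝ, ∀ i, nearestDist (t * w i) ≥ 1 / (k + 1))
    (hgcd : Finset.univ.gcd w = 1) {S : Finset (Fin k)} (hS : S.card = k - 1) :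
    S.gcd w = 1 := by
  by_contra hne
  have hk3 : (3 : ℝ) ≤ k := by exact_mod_cast hk
  obtain ⟨s, hs⟩ := Finset.card_pos.1 (by omega : 0 < S.card)
  have hg0 : S.gcd w ≠ 0 := fun h => (hpos s).ne' (Finset.gcd_eq_zero_iff.1 h s hs)
  have hg2 : 2 ≤ S.gcd w := by omega
  obtain ⟨j, hj⟩ := Finset.card_eq_one.1 (by rw [Finset.card_compl, hS, Fintype.card_fin]; omega :
    Sᶜ.card = 1)
  have mem_or (i : Fin k) : i ∈ S ∨ i = j := by
    by_cases hi : i ∈ S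
    · exact Or.inl hi
    · exact Or.inr (by simpa [hj] using Finset.mem_compl.2 hi)
  have hcop : (S.gcd w).Coprime (w j) := by
    refine Nat.dvd_one.1 (hgcd ▸ Finset.dvd_gcd fun i _ => ?_)
    rcases mem_or i with hi | rfl
    · exact (Nat.gcd_dvd_left _ _).trans (Finset.gcd_dvd hi)
    · exact Nat.gcd_dvd_right _ _
  obtain ⟨t, ht⟩ := H (fun i => w (S.orderEmbOfFin hS i)) (fun _ => hpos _)
    (hinj.comp (S.orderEmbOfFin hS).injective)
  obtain ⟨m, hm⟩ := exists_shift_le_nearestDist t hg2 hcop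
  refine hnoLR ⟨t + m / (S.gcd w : ℕ), fun i => ?_⟩
  rcases mem_or i with hi | rfl
  · obtain ⟨l, rfl⟩ : i ∈ Set.range (S.orderEmbOfFin hS) := by simpa using hi
    obtain ⟨c, hc⟩ := Finset.gcd_dvd (f := w) hi
    have hshift : (t + m / (S.gcd w : ℕ)) * w (S.orderEmbOfFin hS l) =
        t * w (S.orderEmbOfFin hS l) + (m * c : ℤ) := by
      have : (w (S.orderEmbOfFin hS l) : ℝ) = (S.gcd w : ℕ) * c := by exact_mod_cast hc
      have : ((S.gcd w : ℕ) : ℝ) ≠ 0 := by exact_mod_cast hg0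
      rw [add_mul, add_right_inj, ‹(w _ : ℝ) = _›]
      push_cast
      field_simp
    rw [hshift, nearestDist_add_intCast]
    exact le_trans (one_div_le_one_div_of_le (by linarith) (by linarith)) (ht l)
  · exact le_trans (one_div_le_one_div_of_le (by norm_num) (by linarith)) hm

/-- The covering condition applied to the residues of coprime speeds. -/
theorem exists_dvd_of_covering_condition {k : ℕ} (hk : 3 ≤ k)
    (H : ∀ u : Fin (k - 1) → ℕ, (∀ i, 0 < u i) → Function.Injective u →
      ∃ t : ℝ, ∀ i, nearestDist (t * u i) ≥ 1 / k)
    {p : ℕ} (hp : 0 < p)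
    (hcond : ∀ v : Fin k → ℕ, (∀ i, v i < (k + 1) * p) →
      (∀ S : Finset (Fin k), S.card = k - 1 → Nat.gcd (S.gcd v) ((k + 1) * p) = 1) →
      (∀ i, ¬ p ∣ v i) →
      ∃ t : ℕ, t < (k + 1) * p ∧
        ∀ i, nearestDist (((t * v i : ℕ) : ℝ) / ((k + 1) * p)) ≥ 1 / (k + 1))
    {w : Fin k → ℕ} (hpos : ∀ i, 0 < w i) (hinj : Function.Injective w)
    (hnoLR : ¬ ∃ t : ℝ, ∀ i, nearestDist (t * w i) ≥ 1 / (k + 1))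
    (hgcd : Finset.univ.gcd w = 1) : ∃ i, p ∣ w i := by
  by_contra! hndvd
  have hN : 0 < (k + 1) * p := by positivity
  obtain ⟨t, -, ht⟩ := hcond (fun i => w i % ((k + 1) * p)) (fun i => Nat.mod_lt _ hN)
    (fun S hS => by
      rw [← Nat.dvd_one, ← gcd_eq_one_of_not_lonely hk H hpos hinj hnoLR hgcd hS]
      exact Finset.dvd_gcd fun i hi => (Nat.dvd_mod_iff (Nat.gcd_dvd_right _ _)).1
        ((Nat.gcd_dvd_left _ _).trans (Finset.gcd_dvd hi)))
    (fun i h => hndvd i ((Nat.dvd_mod_iff (dvd_mul_left p (k + 1))).1 h))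
  refine hnoLR ⟨t / ((k + 1) * p), fun i => ?_⟩
  have hmod : (w i : ℝ) = (w i % ((k + 1) * p) : ℕ) + (k + 1) * p * (w i / ((k + 1) * p) : ℕ) := by
    exact_mod_cast (Nat.mod_add_div (w i) ((k + 1) * p)).symm
  have hp' : (p : ℝ) ≠ 0 := by positivity
  have hk' : (k + 1 : ℝ) ≠ 0 := by positivity
  have hshift : (t / ((k + 1) * p) * w i : ℝ) =
      ((t * (w i % ((k + 1) * p)) : ℕ) : ℝ) / ((k + 1) * p) +
        ((t * (w i / ((k + 1) * p)) : ℕ) : ℤ) := by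
    rw [hmod, Int.cast_natCast, Nat.cast_mul, Nat.cast_mul]
    field_simp
  rw [hshift, nearestDist_add_intCast]
  exact ht i

/-- Main lemma for finding prime divisors of a counterexample: let `k ≥ 3`, suppose the
lonely runner conjecture holds for `k - 1` speeds, and let `p > 0` be such that every
tuple `v₁, …, v_k ∈ {0, …, (k+1)p - 1}` in which every `(k-1)`-element subset of indices
has `gcd(S ∪ {(k+1)p}) = 1` and no `vᵢ` is divisible by `p` admits an integer time
`t ∈ {0, …, (k+1)p - 1}` with `‖t vᵢ / ((k+1)p)‖ ≥ 1/(k+1)` for all `i`.  Then `p`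
divides the product of the speeds of any set of `k` distinct positive integers without
the lonely runner property. -/
theorem dvd_prod_of_covering_condition (k : ℕ) (hk : 3 ≤ k)
    (H : ∀ u : Fin (k - 1) → ℕ, (∀ i, 0 < u i) → Function.Injective u →
      ∃ t : ℝ, ∀ i, nearestDist (t * u i) ≥ 1 / k)
    (p : ℕ) (hp : 0 < p)
    (hcond : ∀ v : Fin k → ℕ, (∀ i, v i < (k + 1) * p) →
      (∀ S : Finset (Fin k), S.card = k - 1 → Nat.gcd (S.gcd v) ((k + 1) * p) = 1) →
      (∀ i, ¬ p ∣ v i) →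
      ∃ t : ℕ, t < (k + 1) * p ∧
        ∀ i, nearestDist (((t * v i : ℕ) : ℝ) / ((k + 1) * p)) ≥ 1 / (k + 1))
    (w : Fin k → ℕ) (hpos : ∀ i, 0 < w i) (hinj : Function.Injective w)
    (hnoLR : ¬ ∃ t : ℝ, ∀ i, nearestDist (t * w i) ≥ 1 / (k + 1)) :
    p ∣ ∏ i, w i := by
  obtain ⟨i₀⟩ : Nonempty (Fin k) := ⟨⟨0, by omega⟩⟩
  obtain ⟨w', hw', hgcd⟩ := Finset.extract_gcd w ⟨i₀, Finset.mem_univ i₀⟩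
  simp only [Finset.mem_univ, forall_const] at hw'
  have hd : ((Finset.univ.gcd w : ℕ) : ℝ) ≠ 0 := by
    intro h
    have := hpos i₀
    rw [hw', Nat.cast_eq_zero.1 h, zero_mul] at this
    exact this.false
  obtain ⟨i, hi⟩ := exists_dvd_of_covering_condition hk H hp hcond (w := w')
    (fun i => Nat.pos_of_mul_pos_left (hw' i ▸ hpos i))
    (fun i j hij => hinj (by rw [hw' i, hw' j, hij]))
    (fun ⟨t, ht⟩ => hnoLR ⟨t / (Finset.univ.gcd w : ℕ), fun i => by
      have hti : t / (Finset.univ.gcd w : ℕ) * (w i : ℝ) = t * w' i := by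
        have : (w i : ℝ) = (Finset.univ.gcd w : ℕ) * w' i := by exact_mod_cast hw' i
        rw [this]
        field_simp
      rw [hti]
      exact ht i⟩)
    hgcd
  exact (hi.trans (hw' i ▸ dvd_mul_left _ _)).trans (Finset.dvd_prod_of_mem w (Finset.mem_univ i))
end
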